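/- Let δ ∈ (0, (1 + γ)/(2/k + 1 + γ)). Then for every y ∈ Y and every x ∈ Sⁿ with x ≠ r and Π(x)∇V^y(x) = 0, the synergy gap satisfies μ(x,y) := V(x,y) − min_{ȳ ∈ Y} V(x,ȳ) > δ. In other words, V is a centrally synergistic potential function on Sⁿ relative to r with synergy gap exceeding δ. -/

import Mathlib

open scoped RealInnerProductSpace

/-- The synergistic potential function `V(x,y) = (1 - ⟪r,x⟫)/((1 - ⟪r,x⟫) + k(1 - ⟪y,x⟫))`. -/
noncomputable def synV {n : ℕ} (k : ℝ) (r x y : EuclideanSpace ℝ (Fin (n + 1))) : ℝ :=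
  (1 - ⟪r, x⟫) / ((1 - ⟪r, x⟫) + k * (1 - ⟪y, x⟫))

/-- The gradient at `x` of the map `x ↦ V(x,y)` for fixed `y`. -/
noncomputable def gradVy {n : ℕ} (k : ℝ) (r y x : EuclideanSpace ℝ (Fin (n + 1))) :
    EuclideanSpace ℝ (Fin (n + 1)) :=
  gradient (fun z => (1 - ⟪r, z⟫) / ((1 - ⟪r, z⟫) + k * (1 - ⟪y, z⟫))) x

/-- `Π(x)w = w - (xᵀw) x`, the orthogonal projection onto the tangent space to `Sⁿ` at `x`
(for `‖x‖ = 1` this is `(I - x xᵀ) w`). -/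
noncomputable def tangProj {n : ℕ} (x w : EuclideanSpace ℝ (Fin (n + 1))) :
    EuclideanSpace ℝ (Fin (n + 1)) :=
  w - ⟪x, w⟫ • x

/-- `m_V(x) = min_{ȳ ∈ Y} V(x,ȳ)`, where `Y = {y ∈ Sⁿ : ⟪r,y⟫ ≤ γ}`. -/
noncomputable def minVy {n : ℕ} (k γ : ℝ) (r x : EuclideanSpace ℝ (Fin (n + 1))) : ℝ :=
  sInf {v : ℝ | ∃ y : EuclideanSpace ℝ (Fin (n + 1)),
    ‖y‖ = 1 ∧ ⟪r, y⟫ ≤ γ ∧ v = synV k r x y}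

theorem grad_aux {n : ℕ} (k : ℝ) (r y x : EuclideanSpace ℝ (Fin (n + 1)))
    (hD : (1 - ⟪r, x⟫) + k * (1 - ⟪y, x⟫) ≠ 0) :
    gradVy k r y x = (k / ((1 - ⟪r, x⟫) + k * (1 - ⟪y, x⟫)) ^ 2) •
      ((1 - ⟪r, x⟫) • y - (1 - ⟪y, x⟫) • r) := by
  unfold gradVy
  apply HasGradientAt.gradient
  rw [hasGradientAt_iff_hasFDerivAt]
  have h1 : HasFDerivAt (fun z => ⟪r, z⟫) (innerSL ℝ r) x := (innerSL ℝ r).hasFDerivAt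
  have h2 : HasFDerivAt (fun z => ⟪y, z⟫) (innerSL ℝ y) x := (innerSL ℝ y).hasFDerivAt
  have h3 := h1.const_sub 1
  have h4 := h3.add ((h2.const_sub 1).const_mul k)
  have h5 := h3.mul ((hasDerivAt_inv hD).comp_hasFDerivAt x h4)
  have h6 := h5.congr_fderiv (g' := (InnerProductSpace.toDual ℝ (EuclideanSpace ℝ (Fin (n + 1))))
      ((k / (1 - ⟪r, x⟫ + k * (1 - ⟪y, x⟫)) ^ 2) • ((1 - ⟪r, x⟫) • y - (1 - ⟪y, x⟫) • r))) ?_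
  · simp only [div_eq_mul_inv] at h6 ⊢
    exact h6
  ext w
  simp [inner_sub_left, inner_smul_left]
  field_simp
  ring

theorem stmt13 (n : ℕ) (hn : 1 ≤ n) (k : ℝ) (hk : 0 < k) (γ : ℝ) (hγ : -1 < γ ∧ γ < 1)
    (r : EuclideanSpace ℝ (Fin (n + 1))) (hr : ‖r‖ = 1)
    (δ : ℝ) (hδ : 0 < δ ∧ δ < (1 + γ) / (2 / k + 1 + γ)) :
    ∀ y : EuclideanSpace ℝ (Fin (n + 1)), ‖y‖ = 1 → ⟪r, y⟫ ≤ γ →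
      ∀ x : EuclideanSpace ℝ (Fin (n + 1)), ‖x‖ = 1 → x ≠ r →
        tangProj x (gradVy k r y x) = 0 →
        synV k r x y - minVy k γ r x > δ := by
  intro y hy hry x hx hxr hg
  obtain ⟨hγ1, hγ2⟩ := hγ
  have le1 : ∀ u v : EuclideanSpace ℝ (Fin (n + 1)), ‖u‖ = 1 → ‖v‖ = 1 → ⟪u, v⟫ ≤ 1 := by
    intro u v hu hv
    have := real_inner_le_norm u v
    rwa [hu, hv, one_mul] at this
  have self1 : ∀ u : EuclideanSpace ℝ (Fin (n + 1)), ‖u‖ = 1 → ⟪u, u⟫ = 1 := by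
    intro u hu
    rw [real_inner_self_eq_norm_sq, hu]; norm_num
  have ha : 0 < 1 - ⟪r, x⟫ := by
    have h := le1 r x hr hx
    rcases h.lt_or_eq with h | h
    · linarith
    · exact absurd ((inner_eq_one_iff_of_norm_eq_one hr hx).1 h).symm hxr
  have hb : 0 ≤ 1 - ⟪y, x⟫ := by linarith [le1 y x hy hx]
  have hD : 0 < (1 - ⟪r, x⟫) + k * (1 - ⟪y, x⟫) := by positivity
  have hxy : x = y := by
    rw [grad_aux k r y x hD.ne'] at hg
    unfold tangProj at hg
    rw [inner_smul_right, mul_smul, ← smul_sub] at hg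
    have hc : k / ((1 - ⟪r, x⟫) + k * (1 - ⟪y, x⟫)) ^ 2 ≠ 0 := by positivity
    have h0 := (smul_eq_zero.1 hg).resolve_left hc
    have h1 := congrArg (fun v => ⟪v, y⟫) h0
    have h2 := congrArg (fun v => ⟪v, r⟫) h0
    simp only [inner_sub_left, inner_smul_left, inner_sub_right, inner_smul_right, inner_zero_left,
      self1 y hy, self1 r hr, real_inner_comm x y, real_inner_comm x r, real_inner_comm r y,
      conj_trivial] at h1 h2
    have h12 : (1 - ⟪r, x⟫) * (1 - ⟪y, x⟫) * (1 - ⟪r, y⟫) = 0 := by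
      rw [real_inner_comm x r, real_inner_comm x y]
      linear_combination (1 - ⟪x, r⟫) * h1 / 2 - (1 - ⟪x, y⟫) * h2 / 2
    have h3 : 1 - ⟪r, y⟫ ≠ 0 := by linarith
    have h4 : 1 - ⟪y, x⟫ = 0 := by
      rcases mul_eq_zero.1 h12 with h | h
      · exact (mul_eq_zero.1 h).resolve_left ha.ne'
      · exact absurd h h3
    have h5 : ⟪y, x⟫ = 1 := by linarith
    exact ((inner_eq_one_iff_of_norm_eq_one hy hx).1 h5).symm
  subst hxy
  obtain ⟨u, hu, hur, hux⟩ : ∃ u : EuclideanSpace ℝ (Fin (n + 1)),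
      ‖u‖ = 1 ∧ ⟪r, u⟫ = 0 ∧ ⟪u, x⟫ ≤ 0 := by
    have hr0 : r ≠ 0 := by rintro rfl; simp at hr
    haveI : Fact (Module.finrank ℝ (EuclideanSpace ℝ (Fin (n + 1))) = n + 1) := ⟨by simp⟩
    have hf := Submodule.finrank_orthogonal_span_singleton (𝕜 := ℝ) (n := n) hr0
    have hne : (Submodule.span ℝ {r})ᗮ ≠ ⊥ := by
      intro h
      rw [h, finrank_bot] at hf
      omega
    obtain ⟨v, hv, hv0⟩ := Submodule.exists_mem_ne_zero_of_ne_bot hne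
    have hrv : ⟪r, v⟫ = 0 := Submodule.mem_orthogonal_singleton_iff_inner_right.1 hv
    have hw : ‖‖v‖⁻¹ • v‖ = 1 := by simp [norm_smul, hv0]
    have hrw : ⟪r, ‖v‖⁻¹ • v⟫ = 0 := by rw [inner_smul_right, hrv, mul_zero]
    rcases le_total ⟪‖v‖⁻¹ • v, x⟫ 0 with h | h
    · exact ⟨_, hw, hrw, h⟩
    · exact ⟨-(‖v‖⁻¹ • v), by rw [norm_neg, hw], by rw [inner_neg_right, hrw, neg_zero],
        by rw [inner_neg_left]; linarith⟩
  set s := Real.sqrt (1 - γ ^ 2) with hs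
  have hs2 : s ^ 2 = 1 - γ ^ 2 := Real.sq_sqrt (by nlinarith)
  have hs0 : 0 ≤ s := Real.sqrt_nonneg _
  set z := γ • r + s • u with hz
  have hur' : ⟪u, r⟫ = 0 := by rw [real_inner_comm]; exact hur
  have hzn : ‖z‖ = 1 := by
    have : ‖z‖ ^ 2 = 1 := by
      rw [← real_inner_self_eq_norm_sq, hz]
      simp only [inner_add_left, inner_add_right, inner_smul_left, inner_smul_right, self1 r hr,
        self1 u hu, hur, hur', conj_trivial]
      linear_combination hs2
    nlinarith [norm_nonneg z]
  have hzr : ⟪r, z⟫ ≤ γ := by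
    rw [hz, inner_add_right, inner_smul_right, inner_smul_right, self1 r hr, hur]; simp
  have hzx : ⟪z, x⟫ ≤ γ * ⟪r, x⟫ := by
    rw [hz, inner_add_left, real_inner_smul_left, real_inner_smul_left]
    nlinarith
  have hmin : minVy k γ r x ≤ synV k r x z := by
    apply csInf_le
    · refine ⟨0, ?_⟩
      rintro v ⟨w, hw, -, rfl⟩
      have := le1 w x hw hx
      unfold synV
      have h1 : 0 ≤ 1 - ⟪w, x⟫ := by linarith
      positivity
    · exact ⟨z, hzn, hzr, rfl⟩
  have hV1 : synV k r x x = 1 := by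
    unfold synV
    rw [self1 x hx, sub_self, mul_zero, add_zero, div_self ha.ne']
  have ht : -1 ≤ ⟪r, x⟫ := by
    have := le1 (-r) x (by rw [norm_neg, hr]) hx
    rw [inner_neg_left] at this; linarith
  have hkey : (1 - ⟪r, x⟫) * (1 + γ) ≤ 2 * (1 - ⟪z, x⟫) := by
    nlinarith [mul_nonneg (by linarith : 0 ≤ 1 - γ) (by linarith : 0 ≤ 1 + ⟪r, x⟫)]
  have hzb : 0 ≤ 1 - ⟪z, x⟫ := by linarith [le1 z x hzn hx]
  have hfin : synV k r x z ≤ 1 - (1 + γ) / (2 / k + 1 + γ) := by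
    have hg1 : 0 < 1 + γ := by linarith
    have h2k : 0 < 2 / k := by positivity
    have e : 1 - (1 + γ) / (2 / k + 1 + γ) = 2 / (2 + k * (1 + γ)) := by
      have : 2 / k + 1 + γ ≠ 0 := by linarith
      have : 2 + k * (1 + γ) ≠ 0 := by positivity
      have e2 : 2 / k + 1 + γ = (2 + k * (1 + γ)) / k := by field_simp; ring
      rw [e2]
      field_simp
      ring
    rw [e]
    unfold synV
    rw [div_le_div_iff₀ (by positivity) (by positivity)]
    nlinarith
  linarith [hδ.2]
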